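/- For every fair division instance with social impact (with n agents and additive valuations and social impacts), there exists an EF2 allocation A such that n · SW(A) ≥ opt, i.e., an EF2 allocation that is an n-approximation of the maximum utilitarian social welfare. -/

import Mathlib

open Finset

/-- An allocation: pairwise disjoint bundles covering all goods. -/
def IsAllocation {n : ℕ} {G : Type} (A : Fin n → Finset G) : Prop :=
  (∀ i j, i ≠ j → Disjoint (A i) (A j)) ∧ ∀ g, ∃ i, g ∈ A i

/-- Utilitarian social welfare with respect to additive social impacts `s`. -/
def SW {n : ℕ} {G : Type} (s : Fin n → G → NNReal) (A : Fin n → Finset G) : NNReal :=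
  ∑ i, ∑ g ∈ A i, s i g

/-- Envy-freeness up to `k` goods for additive valuations `v`. -/
def EFk {n : ℕ} {G : Type} [DecidableEq G] (v : Fin n → G → NNReal) (k : ℕ)
    (A : Fin n → Finset G) : Prop :=
  ∀ i j, A j = ∅ ∨ ∃ S ⊆ A j, S.card ≤ k ∧ ∑ g ∈ A j \ S, v i g ≤ ∑ g ∈ A i, v i g

/-- Envy-freeness up to one good, for a family of bundles that need not cover all goods. -/
def EnvyFreeUpToOne {n : ℕ} {G : Type} [DecidableEq G] (v : Fin n → G → NNReal)
    (A : Fin n → Finset G) : Prop :=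
  ∀ i j, ∃ S ⊆ A j, S.card ≤ 1 ∧ ∑ g ∈ A j \ S, v i g ≤ ∑ g ∈ A i, v i g

theorem exists_top_subset {G : Type} [DecidableEq G] (w : G → NNReal) (O : Finset G) (k : ℕ)
    (hk : k ≤ O.card) :
    ∃ T ⊆ O, T.card = k ∧ ∀ a ∈ T, ∀ b ∈ O \ T, w b ≤ w a := by
  induction k with
  | zero => exact ⟨∅, by simp, by simp, by simp⟩
  | succ k ih =>
    obtain ⟨T, hTO, hTk, hT⟩ := ih (by omega)
    have hne : (O \ T).Nonempty := by
      rw [← Finset.card_pos, Finset.card_sdiff_of_subset hTO]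
      omega
    obtain ⟨x, hx, hmax⟩ := Finset.exists_max_image (O \ T) w hne
    have hx' := Finset.mem_sdiff.1 hx
    refine ⟨insert x T, Finset.insert_subset hx'.1 hTO, ?_, ?_⟩
    · rw [Finset.card_insert_of_notMem hx'.2, hTk]
    · intro a ha b hb
      simp only [Finset.mem_sdiff, Finset.mem_insert, not_or] at hb
      have hb' : b ∈ O \ T := Finset.mem_sdiff.2 ⟨hb.1, hb.2.2⟩
      rcases Finset.mem_insert.1 ha with rfl | ha
      · exact hmax b hb'
      · exact hT a ha b hb'

/-- A nonempty set `O` splits into a good `h` and disjoint categories of size at most `n`,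
so that `h` together with one good from each full category carries a `1 / n` fraction of the
weight of `O`. -/
theorem exists_categories {G : Type} [DecidableEq G] {n : ℕ} (hn : 0 < n) (w : G → NNReal)
    (O : Finset G) (hO : O.Nonempty) :
    ∃ h ∈ O, ∃ 𝒞 : Finset (Finset G),
      (𝒞 : Set (Finset G)).PairwiseDisjoint id ∧ (∀ C ∈ 𝒞, C.card ≤ n) ∧
      𝒞.biUnion id = O.erase h ∧
      ∀ A : Finset G, (∀ C ∈ 𝒞, C.card = n → (A ∩ C).Nonempty) →
        ∑ g ∈ O, w g ≤ n * (w h + ∑ g ∈ A ∩ O.erase h, w g) := by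
  induction hc : O.card using Nat.strong_induction_on generalizing O with
  | _ c ih =>
  by_cases hcn : O.card ≤ n
  · obtain ⟨h, hh, hmax⟩ := Finset.exists_max_image O w hO
    refine ⟨h, hh, {O.erase h}, by simp, ?_, by simp, fun A _ => ?_⟩
    · simpa using (Finset.card_erase_le.trans hcn)
    · calc ∑ g ∈ O, w g ≤ O.card • w h := Finset.sum_le_card_nsmul _ _ _ hmax
        _ ≤ n * w h := by rw [nsmul_eq_mul]; gcongr
        _ ≤ _ := by gcongr; exact le_self_add
  · obtain ⟨T, hTO, hTn, hT⟩ := exists_top_subset w O n (by omega)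
    have hcard : (O \ T).card = O.card - n := by
      rw [Finset.card_sdiff_of_subset hTO, hTn]
    obtain ⟨h', hh', 𝒞, hdisj, hsize, hunion, hweight⟩ :=
      ih (O \ T).card (by omega) (O \ T) (Finset.card_pos.1 (by omega)) rfl
    obtain ⟨h, hh, hmax⟩ := Finset.exists_max_image T w (Finset.card_pos.1 (by omega))
    have hh'T := (Finset.mem_sdiff.1 hh').2
    have hsub : ∀ C ∈ 𝒞, C ⊆ (O \ T).erase h' := fun C hC => by
      rw [← hunion]; exact Finset.subset_biUnion_of_mem id hC
    have hnew : ∀ C ∈ 𝒞, Disjoint (insert h' (T.erase h)) C := fun C hC => by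
      rw [Finset.disjoint_left]
      intro x hx hxC
      have := hsub C hC hxC
      simp only [Finset.mem_erase, Finset.mem_sdiff, Finset.mem_insert] at this hx
      tauto
    have hcardnew : (insert h' (T.erase h)).card = n := by
      rw [Finset.card_insert_of_notMem (fun hx => hh'T (Finset.mem_of_mem_erase hx)),
        Finset.card_erase_of_mem hh, hTn]
      omega
    refine ⟨h, hTO hh, insert (insert h' (T.erase h)) 𝒞, ?_, ?_, ?_, ?_⟩
    · rw [Finset.coe_insert]
      exact hdisj.insert fun C hC _ => hnew C hC
    · intro C hC
      rcases Finset.mem_insert.1 hC with rfl | hC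
      · exact hcardnew.le
      · exact hsize C hC
    · rw [Finset.biUnion_insert, hunion]
      ext x
      have : x ∈ T → x ∈ O := fun hx => hTO hx
      simp only [id, Finset.mem_union, Finset.mem_insert, Finset.mem_erase, Finset.mem_sdiff]
      grind
    · intro A hA
      obtain ⟨a, ha⟩ := hA _ (Finset.mem_insert_self _ _) hcardnew
      obtain ⟨haA, ha⟩ := Finset.mem_inter.1 ha
      have haw : w h' ≤ w a := by
        rcases Finset.mem_insert.1 ha with rfl | ha
        · exact le_rfl
        · exact hT a (Finset.mem_of_mem_erase ha) h' hh'
      have haO : a ∉ A ∩ (O \ T).erase h' := by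
        simp only [Finset.mem_inter, Finset.mem_erase, Finset.mem_sdiff, Finset.mem_insert] at ha ⊢
        tauto
      have hins : insert a (A ∩ (O \ T).erase h') ⊆ A ∩ O.erase h := by
        intro x hx
        have : ∀ y, y ∈ T → y ∈ O := fun y hy => hTO hy
        simp only [Finset.mem_inter, Finset.mem_erase, Finset.mem_sdiff, Finset.mem_insert]
          at ha hx ⊢
        grind
      have hrest := hweight A fun C hC => hA C (Finset.mem_insert_of_mem hC)
      calc ∑ g ∈ O, w g = ∑ g ∈ T, w g + ∑ g ∈ O \ T, w g := by
            rw [add_comm, Finset.sum_sdiff hTO]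
        _ ≤ n * w h + n * (w h' + ∑ g ∈ A ∩ (O \ T).erase h', w g) := by
            refine add_le_add ?_ hrest
            have := Finset.sum_le_card_nsmul T w (w h) hmax
            rwa [hTn, nsmul_eq_mul] at this
        _ ≤ n * w h + n * (w a + ∑ g ∈ A ∩ (O \ T).erase h', w g) := by gcongr
        _ = n * (w h + ∑ g ∈ insert a (A ∩ (O \ T).erase h'), w g) := by
            rw [Finset.sum_insert haO]; ring
        _ ≤ _ := by gcongr

/-- A relation in which every element of a nonempty finite set has a predecessor in the set
contains a cycle, here given by a permutation moving its support along the relation. -/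
theorem exists_perm_of_forall_exists_rel {α : Type} [Finite α] (r : α → α → Prop)
    (hr : ∀ a, ¬ r a a) (T : Set α) (hT : T.Nonempty) (h : ∀ j ∈ T, ∃ i ∈ T, r i j) :
    ∃ σ : Equiv.Perm α, σ ≠ 1 ∧ ∀ i, σ i = i ∨ r i (σ i) := by
  classical
  choose! f hfT hf using h
  let F : T → T := fun x => ⟨f x, hfT x x.2⟩
  obtain ⟨x₀, hx₀⟩ := hT
  obtain ⟨a, b, hab, heq⟩ :=
    Finite.exists_ne_map_eq_of_infinite (fun k : ℕ => F^[k] ⟨x₀, hx₀⟩)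
  obtain ⟨y, hy⟩ : ∃ y, y ∈ Function.periodicPts F := by
    wlog hlt : a < b generalizing a b
    · exact this b a hab.symm heq.symm (by omega)
    refine ⟨F^[a] ⟨x₀, hx₀⟩, Function.mk_mem_periodicPts (n := b - a) (by omega) ?_⟩
    simp only [Function.IsPeriodicPt, Function.IsFixedPt]
    rw [← Function.iterate_add_apply, Nat.sub_add_cancel hlt.le]
    exact heq.symm
  let e : Equiv.Perm (Function.periodicPts F) := (Function.bijOn_periodicPts F).equiv F
  let τ : Equiv.Perm α := (Equiv.Perm.ofSubtype (p := (· ∈ T))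
    (Equiv.Perm.ofSubtype (p := (· ∈ Function.periodicPts F)) e))
  have hτ : ∀ j, τ j = j ∨ r (τ j) j := by
    intro j
    by_cases hj : j ∈ T
    · by_cases hp : (⟨j, hj⟩ : T) ∈ Function.periodicPts F
      · right
        have : τ j = f j := by
          simp only [τ]
          rw [Equiv.Perm.ofSubtype_apply_of_mem _ hj, Equiv.Perm.ofSubtype_apply_of_mem _ hp]
          rfl
        rw [this]
        exact hf j hj
      · left
        simp only [τ]
        rw [Equiv.Perm.ofSubtype_apply_of_mem _ hj, Equiv.Perm.ofSubtype_apply_of_not_mem _ hp]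
    · left
      exact Equiv.Perm.ofSubtype_apply_of_not_mem _ hj
  have hτy : τ y = f y := by
    simp only [τ]
    rw [Equiv.Perm.ofSubtype_apply_of_mem _ y.2, Equiv.Perm.ofSubtype_apply_of_mem _ hy]
    rfl
  refine ⟨τ⁻¹, fun h1 => ?_, fun i => ?_⟩
  · rw [inv_eq_one] at h1
    rw [h1, Equiv.Perm.one_apply] at hτy
    have := hf y y.2
    rw [← hτy] at this
    exact hr _ this
  · rcases hτ (τ⁻¹ i) with h | h
    · left; simpa using h.symm
    · right; simpa using h

/-- The bundles of an allocation that is envy-free up to one good can be permuted so that the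
allocation stays so and every nonempty set of agents has a member that no agent in the set
envies. -/
theorem exists_perm_acyclic {n : ℕ} {G : Type} [DecidableEq G] (v : Fin n → G → NNReal)
    (A : Fin n → Finset G) (hA : EnvyFreeUpToOne v A) :
    ∃ σ : Equiv.Perm (Fin n), EnvyFreeUpToOne v (A ∘ σ) ∧
      ∀ T : Finset (Fin n), T.Nonempty → ∃ j ∈ T, ∀ i ∈ T,
        ∑ g ∈ A (σ j), v i g ≤ ∑ g ∈ A (σ i), v i g := by
  classical
  obtain ⟨σ, hσ, hmax⟩ := Finset.exists_max_image
    (Finset.univ.filter fun σ : Equiv.Perm (Fin n) => EnvyFreeUpToOne v (A ∘ σ))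
    (fun σ => ∑ i, ∑ g ∈ A (σ i), v i g) ⟨1, by simpa using hA⟩
  have hσ' := (Finset.mem_filter.1 hσ).2
  refine ⟨σ, hσ', fun T hT => ?_⟩
  by_contra! hcon
  obtain ⟨τ, hτ1, hτ⟩ := exists_perm_of_forall_exists_rel
    (fun i j => ∑ g ∈ A (σ i), v i g < ∑ g ∈ A (σ j), v i g) (fun _ => lt_irrefl _)
    (T : Set (Fin n)) hT hcon
  have hle : ∀ i, ∑ g ∈ A (σ i), v i g ≤ ∑ g ∈ A (σ (τ i)), v i g := fun i => by
    rcases hτ i with h | h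
    · rw [h]
    · exact h.le
  refine absurd (hmax (σ * τ) ?_) (not_le.2 ?_)
  · refine Finset.mem_filter.2 ⟨Finset.mem_univ _, fun i j => ?_⟩
    obtain ⟨S, hS, hS1, hSv⟩ := hσ' i (τ j)
    exact ⟨S, hS, hS1, hSv.trans (hle i)⟩
  · refine Finset.sum_lt_sum (fun i _ => hle i) ?_
    obtain ⟨i, hi⟩ : ∃ i, τ i ≠ i := by
      by_contra! h
      exact hτ1 (Equiv.ext h)
    exact ⟨i, Finset.mem_univ _, (hτ i).resolve_left hi⟩

/-- Agents in `T` pick at most one good each from `C`, in an order refining an acyclic relation. -/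
theorem exists_picks {n : ℕ} {G : Type} [DecidableEq G] (v : Fin n → G → NNReal)
    (r : Fin n → Fin n → Prop)
    (hr : ∀ T : Finset (Fin n), T.Nonempty → ∃ j ∈ T, ∀ i ∈ T, ¬ r i j)
    (T : Finset (Fin n)) (C : Finset G) (hC : C.card ≤ T.card) :
    ∃ P : Fin n → Finset G, (∀ i, (P i).card ≤ 1) ∧ (∀ i, P i ⊆ C) ∧ (∀ i ∉ T, P i = ∅) ∧
      (∀ i j, i ≠ j → Disjoint (P i) (P j)) ∧ (∀ g ∈ C, ∃ i, g ∈ P i) ∧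
      ∀ i ∈ T, ∀ j ∈ T, r i j → ∑ g ∈ P j, v i g ≤ ∑ g ∈ P i, v i g := by
  induction hc : C.card generalizing T C with
  | zero =>
    rw [Finset.card_eq_zero] at hc
    subst hc
    exact ⟨fun _ => ∅, by simp, by simp, by simp, by simp, by simp, by simp⟩
  | succ c ih =>
    obtain ⟨j, hj, hsource⟩ := hr T (Finset.card_pos.1 (by omega))
    obtain ⟨x, hx, hmax⟩ := Finset.exists_max_image C (v j) (Finset.card_pos.1 (by omega))
    have hCx := Finset.card_erase_of_mem hx
    obtain ⟨P, hP1, hPC, hPT, hPd, hPu, hPv⟩ := ih (T.erase j) (C.erase x)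
      (by rw [hCx, Finset.card_erase_of_mem hj]; omega) (by omega)
    have hxP : ∀ i, x ∉ P i := fun i hi => by simpa using hPC i hi
    refine ⟨Function.update P j {x}, ?_, ?_, ?_, ?_, ?_, ?_⟩
    · intro i
      rcases eq_or_ne i j with rfl | h
      · simp
      · simpa [h] using hP1 i
    · intro i
      rcases eq_or_ne i j with rfl | h
      · simpa using hx
      · simpa [h] using (hPC i).trans (Finset.erase_subset _ _)
    · intro i hi
      have h : i ≠ j := fun h => hi (h ▸ hj)
      simpa [h] using hPT i (fun hi' => hi (Finset.mem_of_mem_erase hi'))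
    · intro i k hik
      rcases eq_or_ne i j with rfl | h
      · simpa [hik.symm] using hxP k
      · rcases eq_or_ne k j with rfl | h'
        · simpa [h] using hxP i
        · simpa [h, h'] using hPd i k hik
    · intro g hg
      rcases eq_or_ne g x with rfl | h
      · exact ⟨j, by simp⟩
      · obtain ⟨i, hi⟩ := hPu g (Finset.mem_erase.2 ⟨h, hg⟩)
        have hij : i ≠ j := by
          rintro rfl
          rw [hPT i (by simp)] at hi
          simp at hi
        exact ⟨i, by simpa [hij] using hi⟩
    · intro i hi k hk hik
      have hkj : k ≠ j := fun h => hsource i hi (h ▸ hik)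
      rcases eq_or_ne i j with rfl | h
      · simp only [Function.update_self, Function.update_of_ne hkj, Finset.sum_singleton]
        calc ∑ g ∈ P k, v i g ≤ (P k).card • v i x := Finset.sum_le_card_nsmul _ _ _
              fun g hg => hmax g (Finset.mem_of_mem_erase (hPC k hg))
          _ ≤ 1 • v i x := nsmul_le_nsmul_left (zero_le) (hP1 k)
          _ = v i x := one_nsmul _
      · simpa [h, hkj] using
          hPv i (Finset.mem_erase.2 ⟨h, hi⟩) k (Finset.mem_erase.2 ⟨hkj, hk⟩) hik

/-- Under disjoint categories of size at most `n`, some allocation is envy-free up to one good and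
gives every agent a good from each full category. -/
theorem exists_envyFreeUpToOne_of_categories {n : ℕ} {G : Type} [DecidableEq G]
    (v : Fin n → G → NNReal) (𝒞 : Finset (Finset G))
    (hdisj : (𝒞 : Set (Finset G)).PairwiseDisjoint id) (hsize : ∀ C ∈ 𝒞, C.card ≤ n) :
    ∃ A : Fin n → Finset G, (∀ i j, i ≠ j → Disjoint (A i) (A j)) ∧
      Finset.univ.biUnion A = 𝒞.biUnion id ∧ EnvyFreeUpToOne v A ∧
      ∀ C ∈ 𝒞, C.card = n → ∀ i, (A i ∩ C).Nonempty := by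
  induction 𝒞 using Finset.induction_on with
  | empty =>
    exact ⟨fun _ => ∅, by simp, by ext; simp, fun _ _ => ⟨∅, by simp⟩, by simp⟩
  | insert C 𝒞 hC ih =>
    obtain ⟨A, hAd, hAu, hAe, hAc⟩ := ih
      (hdisj.subset (by simp)) (fun D hD => hsize D (Finset.mem_insert_of_mem hD))
    obtain ⟨σ, hσe, hσ⟩ := exists_perm_acyclic v A hAe
    obtain ⟨P, hP1, hPC, -, hPd, hPu, hPv⟩ := exists_picks v
      (fun i j => ∑ g ∈ A (σ i), v i g < ∑ g ∈ A (σ j), v i g)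
      (fun T hT => by simpa only [not_lt] using hσ T hT) Finset.univ C
      (by simpa using hsize C (Finset.mem_insert_self _ _))
    have hCd : ∀ D ∈ 𝒞, Disjoint C D := fun D hD =>
      hdisj (by simp) (by simp [hD]) (fun h => hC (h ▸ hD))
    have hAC : ∀ i, Disjoint (A i) C := fun i => by
      rw [Finset.disjoint_left]
      intro g hg hgC
      have : g ∈ 𝒞.biUnion id := hAu ▸ Finset.mem_biUnion.2 ⟨i, Finset.mem_univ _, hg⟩
      obtain ⟨D, hD, hgD⟩ := Finset.mem_biUnion.1 this
      exact Finset.disjoint_left.1 (hCd D hD) hgC hgD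
    have hAP : ∀ i j, Disjoint (A i) (P j) := fun i j => (hAC i).mono_right (hPC j)
    refine ⟨fun i => A (σ i) ∪ P i, ?_, ?_, ?_, ?_⟩
    · intro i j hij
      rw [Finset.disjoint_union_left, Finset.disjoint_union_right, Finset.disjoint_union_right]
      exact ⟨⟨hAd _ _ (σ.injective.ne hij), hAP _ _⟩, (hAP _ _).symm, hPd i j hij⟩
    · rw [Finset.biUnion_insert, ← hAu]
      ext g
      simp only [Finset.mem_biUnion, Finset.mem_univ, true_and, Finset.mem_union, id]
      constructor
      · rintro ⟨i, hi | hi⟩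
        · exact Or.inr ⟨_, hi⟩
        · exact Or.inl (hPC i hi)
      · rintro (hg | ⟨i, hi⟩)
        · obtain ⟨i, hi⟩ := hPu g hg
          exact ⟨i, Or.inr hi⟩
        · exact ⟨σ.symm i, Or.inl (by simpa using hi)⟩
    · intro i j
      rw [Finset.sum_union (hAP _ _)]
      by_cases henvy : ∑ g ∈ A (σ i), v i g < ∑ g ∈ A (σ j), v i g
      · obtain ⟨S, hS, hS1, hSv⟩ := hσe i j
        refine ⟨S, hS.trans Finset.subset_union_left, hS1, ?_⟩
        have hSP : P j \ S = P j :=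
          Finset.sdiff_eq_self_of_disjoint ((hAP _ _).symm.mono_right hS)
        rw [Finset.union_sdiff_distrib, hSP,
          Finset.sum_union ((hAP _ _).mono_left Finset.sdiff_subset)]
        exact add_le_add hSv (hPv i (Finset.mem_univ _) j (Finset.mem_univ _) henvy)
      · refine ⟨P j, Finset.subset_union_right, hP1 j, ?_⟩
        rw [Finset.union_sdiff_cancel_right (hAP _ _)]
        exact (not_lt.1 henvy).trans le_self_add
    · intro D hD hDn i
      rcases Finset.mem_insert.1 hD with rfl | hD
      · have hDP : D = Finset.univ.biUnion P := by
          ext g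
          simp only [Finset.mem_biUnion, Finset.mem_univ, true_and]
          exact ⟨hPu g, fun ⟨i, hi⟩ => hPC i hi⟩
        have hsum : ∑ i, (P i).card = ∑ _i : Fin n, 1 := by
          rw [← Finset.card_biUnion fun i _ j _ hij => hPd i j hij, ← hDP, hDn]
          simp
        have hPi := (Finset.sum_eq_sum_iff_of_le fun i _ => hP1 i).1 hsum i (Finset.mem_univ _)
        obtain ⟨g, hg⟩ := Finset.card_pos.1 (hPi ▸ Nat.one_pos)
        exact ⟨g, Finset.mem_inter.2 ⟨Finset.mem_union_right _ hg, hPC i hg⟩⟩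
      · exact (hAc D hD hDn (σ i)).mono
          (Finset.inter_subset_inter_right Finset.subset_union_left)

/-- For every instance with additive valuations and social impacts, there exists an EF2
allocation `A` that is an `n`-approximation of the maximum utilitarian social welfare:
`SW B ≤ n * SW A` for every allocation `B`. -/
theorem ef2_n_approx (n m : ℕ) (hn : 0 < n)
    (v s : Fin n → Fin m → NNReal) :
    ∃ A : Fin n → Finset (Fin m), IsAllocation A ∧ EFk v 2 A ∧
      ∀ B : Fin n → Finset (Fin m), IsAllocation B → SW s B ≤ (n : NNReal) * SW s A := by
  have howner : ∀ g, ∃ i, ∀ j, s j g ≤ s i g := fun g => by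
    obtain ⟨i, -, hi⟩ := Finset.exists_max_image Finset.univ (fun i => s i g)
      ⟨(⟨0, hn⟩ : Fin n), Finset.mem_univ _⟩
    exact ⟨i, fun j => hi j (Finset.mem_univ _)⟩
  choose o ho using howner
  let O : Fin n → Finset (Fin m) := fun i => Finset.univ.filter fun g => o g = i
  have hOmem : ∀ i g, g ∈ O i ↔ o g = i := by simp [O]
  have hcat : ∀ i, ∃ H ⊆ O i, H.card ≤ 1 ∧ ∃ 𝒞 : Finset (Finset (Fin m)),
      (𝒞 : Set (Finset (Fin m))).PairwiseDisjoint id ∧ (∀ C ∈ 𝒞, C.card ≤ n) ∧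
      𝒞.biUnion id = O i \ H ∧
      ∀ A : Finset (Fin m), (∀ C ∈ 𝒞, C.card = n → (A ∩ C).Nonempty) →
        ∑ g ∈ O i, s i g ≤ n * (∑ g ∈ H, s i g + ∑ g ∈ A ∩ (O i \ H), s i g) := fun i => by
    rcases (O i).eq_empty_or_nonempty with h | h
    · exact ⟨∅, by simp, by simp, ∅, by simp, by simp, by simp [h], by simp [h]⟩
    · obtain ⟨x, hx, 𝒞, h1, h2, h3, h4⟩ := exists_categories hn (s i) (O i) h
      refine ⟨{x}, by simpa using hx, by simp, 𝒞, h1, h2, ?_, ?_⟩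
      · rw [h3, Finset.sdiff_singleton_eq_erase]
      · simpa only [Finset.sdiff_singleton_eq_erase, Finset.sum_singleton] using h4
  choose H hHO hH1 𝒞 hdisj hsize hunion hweight using hcat
  have hsub : ∀ i, ∀ C ∈ 𝒞 i, C ⊆ O i \ H i := fun i C hC => by
    rw [← hunion]; exact Finset.subset_biUnion_of_mem id hC
  obtain ⟨E, hEd, hEu, hEe, hEc⟩ := exists_envyFreeUpToOne_of_categories v
    (Finset.univ.biUnion 𝒞)
    (by
      intro C hC D hD hCD
      simp only [Finset.coe_biUnion, Set.mem_iUnion, Finset.mem_coe] at hC hD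
      obtain ⟨i, -, hC⟩ := hC
      obtain ⟨j, -, hD⟩ := hD
      rcases eq_or_ne i j with rfl | hij
      · exact hdisj i hC hD hCD
      · refine Finset.disjoint_left.2 fun g hgC hgD => hij ?_
        rw [← (hOmem i g).1 (Finset.mem_sdiff.1 (hsub i C hC hgC)).1,
          ← (hOmem j g).1 (Finset.mem_sdiff.1 (hsub j D hD hgD)).1])
    (by
      intro C hC
      obtain ⟨i, -, hC⟩ := Finset.mem_biUnion.1 hC
      exact hsize i C hC)
  have hEmem : ∀ g, (∃ i, g ∈ E i) ↔ g ∉ H (o g) := fun g => by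
    have h1 : (∃ i, g ∈ E i) ↔ g ∈ Finset.univ.biUnion E := by simp
    rw [h1, hEu, Finset.biUnion_biUnion]
    simp only [hunion, Finset.mem_biUnion, Finset.mem_univ, true_and, Finset.mem_sdiff, hOmem]
    exact ⟨fun ⟨i, hi, h⟩ => hi ▸ h, fun h => ⟨_, rfl, h⟩⟩
  have hEH : ∀ i j, Disjoint (E i) (H j) := fun i j => Finset.disjoint_left.2 fun g hE hH =>
    (hEmem g).1 ⟨i, hE⟩ (((hOmem j g).1 (hHO j hH)).symm ▸ hH)
  refine ⟨fun i => E i ∪ H i, ⟨?_, ?_⟩, ?_, ?_⟩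
  · intro i j hij
    rw [Finset.disjoint_union_left, Finset.disjoint_union_right, Finset.disjoint_union_right]
    refine ⟨⟨hEd i j hij, hEH i j⟩, (hEH j i).symm, Finset.disjoint_left.2 fun g hi hj => hij ?_⟩
    rw [← (hOmem i g).1 (hHO i hi), ← (hOmem j g).1 (hHO j hj)]
  · intro g
    by_cases hg : g ∈ H (o g)
    · exact ⟨o g, Finset.mem_union_right _ hg⟩
    · obtain ⟨i, hi⟩ := (hEmem g).2 hg
      exact ⟨i, Finset.mem_union_left _ hi⟩
  · intro i j
    obtain ⟨S, hS, hS1, hSv⟩ := hEe i j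
    refine Or.inr ⟨S ∪ H j, Finset.union_subset_union_left hS,
      (Finset.card_union_le _ _).trans (add_le_add hS1 (hH1 j)), ?_⟩
    calc ∑ g ∈ (E j ∪ H j) \ (S ∪ H j), v i g ≤ ∑ g ∈ E j \ S, v i g := by
          refine Finset.sum_le_sum_of_subset fun g hg => ?_
          simp only [Finset.mem_sdiff, Finset.mem_union] at hg ⊢
          tauto
      _ ≤ ∑ g ∈ E i, v i g := hSv
      _ ≤ _ := Finset.sum_le_sum_of_subset Finset.subset_union_left
  · intro B hB
    have hBsum : SW s B ≤ ∑ g, s (o g) g := by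
      have hBu : (Finset.univ : Finset (Fin m)) = Finset.univ.biUnion B := by
        ext g
        simpa using hB.2 g
      rw [hBu, Finset.sum_biUnion fun i _ j _ hij => hB.1 i j hij]
      exact Finset.sum_le_sum fun i _ => Finset.sum_le_sum fun g _ => ho g i
    have hOsum : ∑ g, s (o g) g = ∑ i, ∑ g ∈ O i, s i g := by
      rw [← Finset.sum_fiberwise Finset.univ o]
      refine Finset.sum_congr rfl fun i _ => Finset.sum_congr rfl fun g hg => ?_
      rw [(hOmem i g).1 hg]
    refine hBsum.trans (hOsum.le.trans ?_)
    rw [SW, Finset.mul_sum]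
    refine Finset.sum_le_sum fun i _ => (hweight i (E i) fun C hC hCn => hEc C
      (Finset.mem_biUnion.2 ⟨i, Finset.mem_univ _, hC⟩) hCn i).trans ?_
    rw [Finset.sum_union (hEH i i), add_comm]
    gcongr
    exact Finset.inter_subset_left
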